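/- arXiv:2304.01847 — 4 statements merged into one kernel-verified Lean document; each statement's English description precedes it below -/
import Mathlib

section
/- Let Λ be a field, R a commutative Λ-algebra, and s ∈ Λ. Let e₊, e₋, f₊, f₋ ∈ R be idempotents, each spanning a one-dimensional ideal. Set x = (2*s)•(e₊ − e₋) and x' = (2*s)•(f₊ − f₋). If x*x' ≠ 0, then the sets of idempotents intersect: e₊ = f₊ or e₊ = f₋ or e₋ = f₊ or e₋ = f₋. -/
/-- If an idempotent `f` does not annihilate `e`, and `e` spans a one-dimensional ideal, then `f`
acts as the identity on `e`. -/
theorem mul_eq_left_of_span_of_mul_ne_zero {Λ R : Type*} [Field Λ] [CommRing R] [Algebra Λ R]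
    {e f : R} (hf : f * f = f) (he : ∀ r : R, ∃ c : Λ, e * r = c • e) (h : e * f ≠ 0) :
    e * f = e := by
  obtain ⟨c, hc⟩ := he f
  have hfix : c • (e * f) = (1 : Λ) • (e * f) := by
    rw [← smul_mul_assoc, ← hc, mul_assoc, hf, one_smul]
  rw [hc, smul_left_injective Λ h hfix, one_smul]

/-- Idempotents spanning one-dimensional ideals are either orthogonal or equal. -/
theorem mul_eq_zero_of_span_of_ne {Λ R : Type*} [Field Λ] [CommRing R] [Algebra Λ R]
    {e f : R} (he : e * e = e) (hf : f * f = f) (hespan : ∀ r : R, ∃ c : Λ, e * r = c • e)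
    (hfspan : ∀ r : R, ∃ c : Λ, f * r = c • f) (hne : e ≠ f) : e * f = 0 := by
  by_contra h
  apply hne
  rw [← mul_eq_left_of_span_of_mul_ne_zero hf hespan h, mul_comm,
    mul_eq_left_of_span_of_mul_ne_zero he hfspan (mul_comm e f ▸ h)]

/-- Lemma on shared idempotents: if `x = (2s)•(e₊ - e₋)` and `x' = (2s)•(f₊ - f₋)` are built
from idempotents spanning one-dimensional ideals and `x * x' ≠ 0`, then the two pairs of
idempotents share an element. -/
theorem shared_idempotent {Λ R : Type*} [Field Λ] [CommRing R] [Algebra Λ R]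
    (s : Λ) (ep em fp fm : R)
    (hep : ep * ep = ep) (hem : em * em = em) (hfp : fp * fp = fp) (hfm : fm * fm = fm)
    (hepspan : ∀ r : R, ∃ c : Λ, ep * r = c • ep)
    (hemspan : ∀ r : R, ∃ c : Λ, em * r = c • em)
    (hfpspan : ∀ r : R, ∃ c : Λ, fp * r = c • fp)
    (hfmspan : ∀ r : R, ∃ c : Λ, fm * r = c • fm)
    (x x' : R) (hx : x = (2 * s) • (ep - em)) (hx' : x' = (2 * s) • (fp - fm))
    (hxx : x * x' ≠ 0) :
    ep = fp ∨ ep = fm ∨ em = fp ∨ em = fm := by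
  by_contra! hne
  obtain ⟨hpp, hpm, hmp, hmm⟩ := hne
  apply hxx
  rw [hx, hx', smul_mul_smul_comm, sub_mul, mul_sub, mul_sub,
    mul_eq_zero_of_span_of_ne hep hfp hepspan hfpspan hpp,
    mul_eq_zero_of_span_of_ne hep hfm hepspan hfmspan hpm,
    mul_eq_zero_of_span_of_ne hem hfp hemspan hfpspan hmp,
    mul_eq_zero_of_span_of_ne hem hfm hemspan hfmspan hmm]
  simp
end

section
/- Let Λ be a field in which 2 ≠ 0, let R be a commutative Λ-algebra, and let β, s ∈ Λ satisfy s² = β and β ≠ 0. Suppose x ∈ R satisfies the cubic equation x³ = (4*β)•x. Define e₊ = (4*s)⁻¹•x + (8*β)⁻¹•(x*x) and e₋ = −(4*s)⁻¹•x + (8*β)⁻¹•(x*x). Then e₊ and e₋ are orthogonal idempotents: e₊*e₊ = e₊, e₋*e₋ = e₋, e₊*e₋ = 0. Moreover x = (2*s)•(e₊ − e₋) and x*x = (4*β)•(e₊ + e₋). -/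
/-- Biran--Membrez construction: if `x³ = (4β)•x` with `β = s² ≠ 0`, then
`e₊ = (4s)⁻¹•x + (8β)⁻¹•x²` and `e₋ = -(4s)⁻¹•x + (8β)⁻¹•x²` are orthogonal idempotents,
`x = (2s)•(e₊ - e₋)` and `x² = (4β)•(e₊ + e₋)`. -/
theorem biran_membrez_idempotents {Λ R : Type*} [Field Λ] [CommRing R] [Algebra Λ R]
    (h2 : (2 : Λ) ≠ 0) (β s : Λ) (hs : s ^ 2 = β) (hβ : β ≠ 0)
    (x : R) (hcubic : x ^ 3 = (4 * β) • x)
    (ep em : R)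
    (hep : ep = (4 * s)⁻¹ • x + (8 * β)⁻¹ • (x * x))
    (hem : em = -((4 * s)⁻¹ • x) + (8 * β)⁻¹ • (x * x)) :
    ep * ep = ep ∧ em * em = em ∧ ep * em = 0 ∧
      x = (2 * s) • (ep - em) ∧ x * x = (4 * β) • (ep + em) := by
  have hs0 : s ≠ 0 := by
    rintro rfl
    exact hβ (by rw [← hs]; ring)
  have h4 : (4 * s)⁻¹ = 2⁻¹ * (2 * s)⁻¹ := by
    rw [← mul_inv]
    ring
  have h8 : (8 * β)⁻¹ = 2⁻¹ * (2 * s)⁻¹ ^ 2 := by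
    rw [inv_pow, ← mul_inv, ← hs]
    ring
  have hU : 2 * algebraMap Λ R 2⁻¹ = 1 := by
    rw [← map_ofNat (algebraMap Λ R) 2, ← map_mul, mul_inv_cancel₀ h2, map_one]
  have hST : 2 * algebraMap Λ R s * algebraMap Λ R (2 * s)⁻¹ = 1 := by
    rw [← map_ofNat (algebraMap Λ R) 2, ← map_mul, ← map_mul,
      mul_inv_cancel₀ (mul_ne_zero h2 hs0), map_one]
  rw [h4, h8] at hep hem
  generalize (2 * s)⁻¹ = t at *
  generalize (2 : Λ)⁻¹ = u at *
  subst hs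
  simp only [Algebra.smul_def, map_mul, map_pow, map_ofNat] at *
  generalize algebraMap Λ R s = S at *
  generalize algebraMap Λ R t = T at *
  generalize algebraMap Λ R u = U at *
  -- The rescaled class `T * x` is a root of `y ^ 3 = y`.
  have hy : (T * x) ^ 3 = T * x := by
    linear_combination T ^ 3 * hcubic + T * x * (2 * S * T + 1) * hST
  subst hep hem
  refine ⟨?_, ?_, ?_, ?_, ?_⟩
  · linear_combination U ^ 2 * (2 + T * x) * hy + U * (T * x + (T * x) ^ 2) * hU
  · linear_combination U ^ 2 * (-2 + T * x) * hy + U * (-(T * x) + (T * x) ^ 2) * hU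
  · linear_combination U ^ 2 * (T * x) * hy
  · linear_combination -x * (2 * S * T) * hU - x * hST
  · linear_combination -x ^ 2 * (4 * S ^ 2 * T ^ 2) * hU - x ^ 2 * (2 * S * T + 1) * hST
end

section
/- Let Λ be a field in which 2 ≠ 0, let R be a commutative Λ-algebra, let s ∈ Λ with s ≠ 0, and set β = s². Let e₊, e₋, f₊, f₋ ∈ R be idempotents with e₊*e₋ = 0, f₊*f₋ = 0, e₊ = f₋, and e₋*f₊ = 0. Set x = (2*s)•(e₊ − e₋), x' = (2*s)•(f₊ − f₋), and y = x + x'. Then y = (2*s)•(f₊ − e₋), and the Biran–Membrez formulas applied to y yield exactly f₊ and e₋: (4*s)⁻¹•y + (8*β)⁻¹•(y*y) = f₊ and −(4*s)⁻¹•y + (8*β)⁻¹•(y*y) = e₋. -/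
/-- Dehn twist computation: if `e₊ = f₋` is the shared idempotent of an A₂-configuration
and `e₋ * f₊ = 0`, then `y = x + x' = (2s)•(f₊ - e₋)` and the Biran--Membrez formulas
applied to `y` yield exactly `f₊` and `e₋`. -/
theorem dehn_twist_idempotents {Λ R : Type*} [Field Λ] [CommRing R] [Algebra Λ R]
    (h2 : (2 : Λ) ≠ 0) (s : Λ) (hs : s ≠ 0) (β : Λ) (hβ : β = s ^ 2)
    (ep em fp fm : R)
    (hep : ep * ep = ep) (hem : em * em = em) (hfp : fp * fp = fp) (hfm : fm * fm = fm)
    (he : ep * em = 0) (hf : fp * fm = 0)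
    (hshare : ep = fm) (horth : em * fp = 0)
    (x x' y : R)
    (hx : x = (2 * s) • (ep - em)) (hx' : x' = (2 * s) • (fp - fm)) (hy : y = x + x') :
    y = (2 * s) • (fp - em) ∧
      (4 * s)⁻¹ • y + (8 * β)⁻¹ • (y * y) = fp ∧
      -((4 * s)⁻¹ • y) + (8 * β)⁻¹ • (y * y) = em := by
  have hy_eq : y = (2 * s) • (fp - em) := by
    rw [hy, hx, hx', hshare, ← smul_add]
    congr 1
    ring
  have h4 : (4 : Λ) = 2 * 2 := by norm_num
  have h8 : (8 : Λ) = 2 * 2 * 2 := by norm_num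
  have hsq : (fp - em) * (fp - em) = fp + em := by
    linear_combination hfp + hem - 2 * horth
  have hlin : (4 * s)⁻¹ • y = (2 : Λ)⁻¹ • (fp - em) := by
    rw [hy_eq, smul_smul, h4]
    congr 1
    field_simp
  have hquad : (8 * β)⁻¹ • (y * y) = (2 : Λ)⁻¹ • (fp + em) := by
    rw [hy_eq, smul_mul_smul_comm, hsq, smul_smul, hβ, h8]
    congr 1
    field_simp
  have hhalf : ∀ a : R, (2 : Λ)⁻¹ • (a + a) = a := fun a => by
    rw [← two_smul Λ a, inv_smul_smul₀ h2]
  refine ⟨hy_eq, ?_, ?_⟩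
  · rw [hlin, hquad, ← smul_add, sub_add_add_cancel, hhalf]
  · rw [hlin, hquad, ← smul_neg, ← smul_add, neg_sub, add_comm fp em, sub_add_add_cancel, hhalf]
end

section
/- Let X be a normal topological space, m ≥ 2, and S : Fin m → Set X a family of nonempty closed subsets such that S i ∩ S j = ∅ whenever the indices satisfy |i − j| ≥ 2. Let ζ : Fin (m−1) → (C(X, ℝ) → ℝ) be a family of functionals such that for each j, both S j and S (j+1) are ζ j-superheavy-and-heavy. Then the functionals ζ j are pairwise distinct: ζ i ≠ ζ j for i ≠ j. -/
/-- A subset `S` is `ζ`-superheavy-and-heavy if for every continuous `H : X → ℝ` and reals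
`a`, `b`: a lower bound of `H` on `S` bounds `ζ H` from below, and an upper bound of `H`
on `S` bounds `ζ H` from above. -/
def SuperheavyHeavy {X : Type*} [TopologicalSpace X] (ζ : C(X, ℝ) → ℝ) (S : Set X) : Prop :=
  ∀ (H : C(X, ℝ)) (a b : ℝ),
    ((∀ x ∈ S, a ≤ H x) → a ≤ ζ H) ∧ ((∀ x ∈ S, H x ≤ b) → ζ H ≤ b)

/-- Two disjoint closed sets in a normal space cannot both be superheavy and heavy for the same
functional: a Urysohn function separates them. -/
theorem SuperheavyHeavy.not_disjoint {X : Type*} [TopologicalSpace X] [NormalSpace X]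
    {ζ : C(X, ℝ) → ℝ} {S T : Set X} (hS : SuperheavyHeavy ζ S) (hT : SuperheavyHeavy ζ T)
    (hSc : IsClosed S) (hTc : IsClosed T) : ¬ Disjoint S T := by
  intro hd
  obtain ⟨f, hf0, hf1, -⟩ := exists_continuous_zero_one_of_isClosed hSc hTc hd
  have h0 : ζ f ≤ 0 := (hS f 0 0).2 fun x hx => (hf0 hx).le
  have h1 : 1 ≤ ζ f := (hT f 1 1).1 fun x hx => (hf1 hx).ge
  linarith

/-- An A_m-configuration pattern: `S i` and `S j` are disjoint whenever `|i - j| ≥ 2`, and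
each functional `ζ j` renders both `S j` and `S (j+1)` superheavy-and-heavy. Then the
`ζ j` are pairwise distinct. -/
theorem Am_configuration_distinct_quasimorphisms {X : Type*} [TopologicalSpace X]
    [NormalSpace X] (m : ℕ) (hm : 2 ≤ m) (S : Fin m → Set X)
    (hne : ∀ i, (S i).Nonempty) (hcl : ∀ i, IsClosed (S i))
    (hdisj : ∀ i j : Fin m, ((i : ℕ) + 2 ≤ (j : ℕ) ∨ (j : ℕ) + 2 ≤ (i : ℕ)) → S i ∩ S j = ∅)
    (ζ : Fin (m - 1) → (C(X, ℝ) → ℝ))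
    (hsh : ∀ j : Fin (m - 1),
      SuperheavyHeavy (ζ j) (S ⟨(j : ℕ), by have := j.isLt; omega⟩) ∧
      SuperheavyHeavy (ζ j) (S ⟨(j : ℕ) + 1, by have := j.isLt; omega⟩)) :
    ∀ i j : Fin (m - 1), i ≠ j → ζ i ≠ ζ j := by
  intro i j hij heq
  wlog hlt : i < j generalizing i j
  · exact this j i hij.symm heq.symm (lt_of_le_of_ne (not_lt.mp hlt) hij.symm)
  have hlt' : (i : ℕ) < j := hlt
  refine (hsh i).1.not_disjoint (heq ▸ (hsh j).2) (hcl _) (hcl _) ?_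
  exact Set.disjoint_iff_inter_eq_empty.mpr (hdisj _ _ (Or.inl (by simp only; omega)))
end
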